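/- Let m ≥ 12 be a natural number, and let A be the matrix with rational entries, with rows indexed by i ∈ {6, 7, …, m} and columns indexed by j ∈ {0, 1, …, ⌊m/2⌋}, whose (i, j)-entry is A_{ij} = Σ_{n=0}^{⌊i/2⌋} 2^{m−n} · i^n · binom(j, n) · binom(m−2j, i−(j+n)), where a summand is understood to be zero unless j + n ≤ i and i − (j+n) ≤ m − 2j. Then the rank of A is at least ⌊m/2⌋ − 5. -/

import Mathlib

/-- The matrix `A` with rows indexed by `i ∈ {6, …, m}` and columns indexed by
`j ∈ {0, …, ⌊m/2⌋}`, with entries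
`A_{ij} = ∑_{n=0}^{⌊i/2⌋} 2^(m-n) * i^n * binom(j, n) * binom(m-2j, i-(j+n))`
(where a summand vanishes unless `j + n ≤ i` and `i - (j+n) ≤ m - 2j`),
has rank at least `⌊m/2⌋ − 5` whenever `m ≥ 12`. -/
theorem rank_lower_bound (m : ℕ) (hm : 12 ≤ m)
    (A : Matrix (Fin (m - 5)) (Fin (m / 2 + 1)) ℚ)
    (hA : ∀ r c, A r c =
      ∑ n ∈ Finset.range ((r.val + 6) / 2 + 1),
        if c.val + n ≤ r.val + 6 ∧ (r.val + 6) - (c.val + n) ≤ m - 2 * c.val then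
          (2 : ℚ) ^ (m - n) * ((r.val + 6 : ℕ) : ℚ) ^ n
            * ((c.val).choose n : ℚ)
            * (((m - 2 * c.val).choose ((r.val + 6) - (c.val + n)) : ℕ) : ℚ)
        else 0) :
    m / 2 - 5 ≤ A.rank := by
  let f : Fin (m / 2 - 5) → Fin (m - 5) := fun t => ⟨t.val, by omega⟩
  let g : Fin (m / 2 - 5) → Fin (m / 2 + 1) := fun t => ⟨t.val + 6, by omega⟩
  have h_upper : ∀ s t : Fin (m / 2 - 5), s < t → A.submatrix f g s t = 0 := by
    intro s t hst
    rw [Matrix.submatrix_apply, hA]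
    refine Finset.sum_eq_zero fun n _ => if_neg ?_
    have : s.val < t.val := hst
    simp only [f, g]
    omega
  have h_diag : ∀ t : Fin (m / 2 - 5), A.submatrix f g t t = 2 ^ m := by
    intro t
    rw [Matrix.submatrix_apply, hA, Finset.sum_eq_single 0]
    · simp [f, g]
    · intro n _ hn
      refine if_neg ?_
      simp only [f, g]
      omega
    · simp
  have h_unit : IsUnit (A.submatrix f g) := by
    rw [Matrix.isUnit_iff_isUnit_det, Matrix.det_of_isLowerTriangular _ h_upper]
    simp [h_diag, -Matrix.submatrix_apply]
  have h_rank := Matrix.rank_of_isUnit _ h_unit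
  rw [Fintype.card_fin] at h_rank
  exact h_rank.symm.trans_le (Matrix.rank_submatrix_le A f g)
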